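/- arXiv:2009.13858 — 6 statements merged into one kernel-verified Lean document; each statement's English description precedes it below -/
import Mathlib

section
/- Let d ≥ 2 be an integer and let ℓ, a be real numbers with 0 < a < ℓ. The set of extreme points of the isocanted alcoved polytope P(d,ℓ,a) is exactly the union of the two families {v_W : W a nonempty subset of {1,…,d}} and {w_S : S a proper (possibly empty) subset of {1,…,d}}, where v_W is the point with i-th coordinate 0 if i ∈ W and a − ℓ otherwise, and w_S is the point with i-th coordinate −a if i ∈ S and −ℓ otherwise. (These extreme points are in bijection with the nonempty proper subsets of {1,…,d+1}.) -/
/-- The isocanted alcoved polytope `P(d, ℓ, a)` as a subset of `ℝ^d`. -/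
def isocantedPolytope (d : ℕ) (ℓ a : ℝ) : Set (Fin d → ℝ) :=
  {x | (∀ i, -ℓ ≤ x i ∧ x i ≤ 0) ∧ ∀ i j, i ≠ j → x i - x j ≤ ℓ - a}

theorem iso_perturb {d : ℕ} {A : Set (Fin d → ℝ)} {x : Fin d → ℝ}
    (hx : x ∈ Set.extremePoints ℝ A) (u : Fin d → ℝ)
    (h1 : (fun i => x i + u i) ∈ A) (h2 : (fun i => x i - u i) ∈ A) : ∀ i, u i = 0 := by
  have h := (mem_extremePoints.1 hx).2 _ h1 _ h2
    ⟨1/2, 1/2, by norm_num, by norm_num, by norm_num, by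
      ext i; simp only [Pi.add_apply, Pi.smul_apply, smul_eq_mul]; ring⟩
  intro i
  have : x i + u i = x i := congrFun h.1 i
  linarith

theorem iso_upper {p q y z c : ℝ} (hp : 0 < p) (hq : 0 < q) (hpq : p + q = 1)
    (hy : y ≤ c) (hz : z ≤ c) (h : p * y + q * z = c) : y = c ∧ z = c := by
  have e : p * (c - y) + q * (c - z) = 0 := by linear_combination c * hpq - h
  have a1 := mul_nonneg hp.le (sub_nonneg.2 hy)
  have a2 := mul_nonneg hq.le (sub_nonneg.2 hz)
  have b1 : p * (c - y) = 0 := by linarith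
  have b2 : q * (c - z) = 0 := by linarith
  rcases mul_eq_zero.1 b1 with h | h <;> rcases mul_eq_zero.1 b2 with h' | h' <;>
    constructor <;> linarith

theorem iso_lower {p q y z c : ℝ} (hp : 0 < p) (hq : 0 < q) (hpq : p + q = 1)
    (hy : c ≤ y) (hz : c ≤ z) (h : p * y + q * z = c) : y = c ∧ z = c := by
  have := iso_upper hp hq hpq (neg_le_neg hy) (neg_le_neg hz) (by linarith)
  constructor <;> linarith [this.1, this.2]

theorem iso_diff {d : ℕ} {ℓ a : ℝ} (haℓ : a < ℓ) {x : Fin d → ℝ}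
    (hx : x ∈ isocantedPolytope d ℓ a) (i j : Fin d) : x i - x j ≤ ℓ - a := by
  by_cases h : i = j
  · subst h; linarith
  · exact hx.2 i j h

/-- Points with all coordinates in a box of side `ℓ - a` inside `[-ℓ, 0]` lie in the polytope;
an extreme point in such a box has all its coordinates at the ends. -/
theorem iso_box {d : ℕ} {ℓ a b : ℝ} (hb : -ℓ ≤ b) (hb' : b + (ℓ - a) ≤ 0) {x : Fin d → ℝ}
    (hx : x ∈ Set.extremePoints ℝ (isocantedPolytope d ℓ a))
    (hbox : ∀ i, b ≤ x i ∧ x i ≤ b + (ℓ - a)) (i : Fin d) : x i = b ∨ x i = b + (ℓ - a) := by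
  have mem : ∀ y : Fin d → ℝ, (∀ i, b ≤ y i ∧ y i ≤ b + (ℓ - a)) →
      y ∈ isocantedPolytope d ℓ a := fun y hy =>
    ⟨fun i => ⟨by linarith [(hy i).1], by linarith [(hy i).2]⟩,
      fun i j _ => by linarith [(hy i).2, (hy j).1]⟩
  set ε := min (x i - b) (b + (ℓ - a) - x i) with hε
  have e1 : ε ≤ x i - b := min_le_left _ _
  have e2 : ε ≤ b + (ℓ - a) - x i := min_le_right _ _
  have e0 : 0 ≤ ε := le_min (by linarith [(hbox i).1]) (by linarith [(hbox i).2])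
  have := iso_perturb hx (fun j => if j = i then ε else 0)
    (mem _ fun j => by
      have := hbox j
      by_cases h : j = i
      · subst h; simp only [if_true]; constructor <;> linarith
      · simp only [h, if_false]; constructor <;> linarith)
    (mem _ fun j => by
      have := hbox j
      by_cases h : j = i
      · subst h; simp only [if_true]; constructor <;> linarith
      · simp only [h, if_false]; constructor <;> linarith) i
  simp only [if_true] at this
  rcases min_choice (x i - b) (b + (ℓ - a) - x i) with h | h
  · left; linarith
  · right; linarith

theorem extremePoints_isocanted (d : ℕ) (hd : 2 ≤ d) (ℓ a : ℝ)
    (ha : 0 < a) (haℓ : a < ℓ) :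
    Set.extremePoints ℝ (isocantedPolytope d ℓ a) =
      {x | ∃ W : Finset (Fin d), W.Nonempty ∧
            x = fun i => if i ∈ W then (0 : ℝ) else a - ℓ} ∪
      {x | ∃ S : Finset (Fin d), S ≠ Finset.univ ∧
            x = fun i => if i ∈ S then -a else -ℓ} := by
  classical
  ext x
  constructor
  · intro hx
    have hP := (mem_extremePoints.1 hx).1
    have hD := iso_diff haℓ hP
    by_cases h0 : ∃ i, x i = 0
    · left
      obtain ⟨k, hk⟩ := h0
      refine ⟨Finset.univ.filter (fun i => x i = 0), ⟨k, by simp [hk]⟩, ?_⟩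
      ext i
      have := iso_box (b := a - ℓ) (by linarith) (by linarith) hx
        (fun i => ⟨by linarith [hD k i], by linarith [(hP.1 i).2]⟩) i
      by_cases hi : x i = 0
      · simp [hi]
      · simp only [Finset.mem_filter, Finset.mem_univ, true_and, hi, if_false]
        rcases this with h | h
        · exact h
        · exact absurd (by linarith) hi
    by_cases h1 : ∃ i, x i = -ℓ
    · right
      obtain ⟨k, hk⟩ := h1
      refine ⟨Finset.univ.filter (fun i => x i ≠ -ℓ), fun h => ?_, ?_⟩
      · have := Finset.mem_univ k
        rw [← h] at this
        simp [hk] at this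
      ext i
      have := iso_box (b := -ℓ) (by linarith) (by linarith) hx
        (fun i => ⟨by linarith [(hP.1 i).1], by linarith [hD i k]⟩) i
      by_cases hi : x i = -ℓ
      · simp [hi]
      · simp only [Finset.mem_filter, Finset.mem_univ, true_and, ne_eq, hi, not_false_eq_true,
          if_true]
        rcases this with h | h
        · exact absurd h hi
        · linarith
    exfalso
    haveI : Nonempty (Fin d) := ⟨⟨0, by omega⟩⟩
    obtain ⟨k, hk⟩ := Finite.exists_min (fun i => min (-x i) (x i + ℓ))
    push Not at h0 h1
    have pos : 0 < min (-x k) (x k + ℓ) := by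
      refine lt_min ?_ ?_
      · have := lt_of_le_of_ne (hP.1 k).2 (h0 k); linarith
      · have := lt_of_le_of_ne (hP.1 k).1 (h1 k).symm; linarith
    have b1 : ∀ i, min (-x k) (x k + ℓ) ≤ -x i := fun i => (hk i).trans (min_le_left _ _)
    have b2 : ∀ i, min (-x k) (x k + ℓ) ≤ x i + ℓ := fun i => (hk i).trans (min_le_right _ _)
    generalize min (-x k) (x k + ℓ) = ε at pos b1 b2
    have := iso_perturb hx (fun _ => ε)
      ⟨fun i => ⟨by linarith [b1 i, b2 i], by linarith [b1 i, b2 i]⟩,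
        fun i j _ => by linarith [hD i j]⟩
      ⟨fun i => ⟨by linarith [b1 i, b2 i], by linarith [b1 i, b2 i]⟩,
        fun i j _ => by linarith [hD i j]⟩ k
    linarith
  · rintro (⟨W, ⟨k, hk⟩, rfl⟩ | ⟨S, hS, rfl⟩)
    · rw [mem_extremePoints]
      refine ⟨⟨fun i => by dsimp only; split_ifs <;> constructor <;> linarith,
        fun i j _ => by dsimp only; split_ifs <;> linarith⟩, ?_⟩
      rintro y hy z hz ⟨p, q, hp, hq, hpq, he⟩
      have he' : ∀ i, p * y i + q * z i = if i ∈ W then (0 : ℝ) else a - ℓ :=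
        fun i => congrFun he i
      have key : ∀ i, i ∈ W → y i = 0 ∧ z i = 0 := fun i hi =>
        iso_upper hp hq hpq (hy.1 i).2 (hz.1 i).2 (by rw [he' i, if_pos hi])
      have key2 : ∀ i, i ∉ W → y i = a - ℓ ∧ z i = a - ℓ := fun i hi =>
        iso_lower hp hq hpq (by linarith [iso_diff haℓ hy k i, (key k hk).1])
          (by linarith [iso_diff haℓ hz k i, (key k hk).2]) (by rw [he' i, if_neg hi])
      constructor <;> ext i <;> by_cases hi : i ∈ W <;> simp [hi, key, key2]
    · obtain ⟨k, hk⟩ : ∃ k, k ∉ S := by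
        by_contra h
        push Not at h
        exact hS (Finset.eq_univ_iff_forall.2 h)
      rw [mem_extremePoints]
      refine ⟨⟨fun i => by dsimp only; split_ifs <;> constructor <;> linarith,
        fun i j _ => by dsimp only; split_ifs <;> linarith⟩, ?_⟩
      rintro y hy z hz ⟨p, q, hp, hq, hpq, he⟩
      have he' : ∀ i, p * y i + q * z i = if i ∈ S then -a else -ℓ :=
        fun i => congrFun he i
      have key : ∀ i, i ∉ S → y i = -ℓ ∧ z i = -ℓ := fun i hi =>
        iso_lower hp hq hpq (hy.1 i).1 (hz.1 i).1 (by rw [he' i, if_neg hi])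
      have key2 : ∀ i, i ∈ S → y i = -a ∧ z i = -a := fun i hi =>
        iso_upper hp hq hpq (by linarith [iso_diff haℓ hy i k, (key k hk).1])
          (by linarith [iso_diff haℓ hz i k, (key k hk).2]) (by rw [he' i, if_pos hi])
      constructor <;> ext i <;> by_cases hi : i ∈ S <;> simp [hi, key, key2]
end

section
/- Let d ≥ 2 be an integer and let ℓ, a be real numbers with 0 < a < ℓ. The set of extreme points (vertices) of the isocanted alcoved polytope P(d,ℓ,a) is finite and has cardinality exactly 2^(d+1) − 2. -/
/-- An extreme point lying in a cube contained in the set is a vertex of the cube. -/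
lemma extreme_cube {d : ℕ} {P : Set (Fin d → ℝ)} {c e : ℝ}
    (hP : ∀ y : Fin d → ℝ, (∀ i, c ≤ y i ∧ y i ≤ e) → y ∈ P) {x : Fin d → ℝ}
    (hx : x ∈ Set.extremePoints ℝ P) (hc : ∀ i, c ≤ x i ∧ x i ≤ e) (i : Fin d) :
    x i = c ∨ x i = e := by
  by_contra! h
  have h1 : c < x i := lt_of_le_of_ne (hc i).1 (Ne.symm h.1)
  have h2 : x i < e := lt_of_le_of_ne (hc i).2 h.2
  have hy : ∀ t, c ≤ t → t ≤ e → Function.update x i t ∈ P := by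
    intro t ht ht'
    apply hP
    intro j
    by_cases hj : j = i
    · subst hj; simp [ht, ht']
    · simpa [hj] using hc j
  have hl : c < e := h1.trans h2
  have hm : x ∈ openSegment ℝ (Function.update x i c) (Function.update x i e) := by
    refine ⟨(e - x i) / (e - c), (x i - c) / (e - c), div_pos (by linarith) (by linarith),
      div_pos (by linarith) (by linarith), ?_, ?_⟩
    · have : e - c ≠ 0 := by linarith
      field_simp
      ring
    · have : e - c ≠ 0 := by linarith
      ext j
      by_cases hj : j = i
      · subst hj
        simp only [Pi.add_apply, Pi.smul_apply, Function.update_self, smul_eq_mul]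
        field_simp
        ring
      · simp only [Pi.add_apply, Pi.smul_apply, Function.update_of_ne hj, smul_eq_mul]
        field_simp
        ring
  have := hx.2 (hy c le_rfl hl.le) (hy e hl.le le_rfl) hm
  have h3 := congrFun this i
  simp at h3
  exact h.1 h3.symm

/-- The vertex with values `p` on `S` and `q` off `S`. -/
noncomputable def isoVert (d : ℕ) (p q : ℝ) (S : Finset (Fin d)) : Fin d → ℝ :=
  fun i => if i ∈ S then p else q

lemma isoVert_injective (d : ℕ) {p q : ℝ} (h : p ≠ q) :
    Function.Injective (isoVert d p q) := by
  intro S T hST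
  ext i
  have := congrFun hST i
  simp only [isoVert] at this
  by_cases h1 : i ∈ S <;> by_cases h2 : i ∈ T <;> simp_all

lemma eq_isoVert {d : ℕ} {p q : ℝ} {x : Fin d → ℝ} (h : ∀ i, x i = p ∨ x i = q) :
    x = isoVert d p q (Finset.univ.filter fun i => x i = p) := by
  ext i
  simp only [isoVert, Finset.mem_filter, Finset.mem_univ, true_and]
  split_ifs with h1
  · exact h1
  · exact (h i).resolve_left h1

lemma seg_eq_low {s t u v c : ℝ} (hs : 0 < s) (ht : 0 < t) (hst : s + t = 1)
    (h : s * u + t * v = c) (hu : c ≤ u) (hv : c ≤ v) : u = c ∧ v = c := by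
  obtain rfl : s = 1 - t := by linarith
  constructor <;> nlinarith

lemma seg_eq_high {s t u v c : ℝ} (hs : 0 < s) (ht : 0 < t) (hst : s + t = 1)
    (h : s * u + t * v = c) (hu : u ≤ c) (hv : v ≤ c) : u = c ∧ v = c := by
  obtain rfl : s = 1 - t := by linarith
  constructor <;> nlinarith

lemma extremePoints_iso (d : ℕ) (hd : 2 ≤ d) (ℓ a : ℝ) (ha : 0 < a) (haℓ : a < ℓ) :
    Set.extremePoints ℝ (isocantedPolytope d ℓ a) =
      isoVert d 0 (a - ℓ) '' {S | S.Nonempty} ∪ isoVert d (-ℓ) (-a) '' {S | S.Nonempty} := by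
  ext x
  constructor
  · intro hx
    have hxP := hx.1
    by_cases h0 : ∃ i, x i = 0
    · left
      obtain ⟨k, hk⟩ := h0
      have := extreme_cube (c := a - ℓ) (e := 0) (P := isocantedPolytope d ℓ a) (fun y hy =>
        ⟨fun i => ⟨by linarith [(hy i).1], (hy i).2⟩,
          fun i j _ => by linarith [(hy i).2, (hy j).1]⟩) hx (fun i => ⟨by
            by_cases hik : k = i
            · subst hik; linarith
            · linarith [hxP.2 k i hik], (hxP.1 i).2⟩)
      exact ⟨_, ⟨k, by simpa using hk⟩, (eq_isoVert fun i => (this i).symm).symm⟩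
    by_cases hl : ∃ i, x i = -ℓ
    · right
      obtain ⟨k, hk⟩ := hl
      have := extreme_cube (c := -ℓ) (e := -a) (P := isocantedPolytope d ℓ a) (fun y hy =>
        ⟨fun i => ⟨(hy i).1, by linarith [(hy i).2]⟩,
          fun i j _ => by linarith [(hy i).2, (hy j).1]⟩) hx (fun i => ⟨(hxP.1 i).1, by
            by_cases hik : i = k
            · subst hik; linarith
            · linarith [hxP.2 i k hik]⟩)
      exact ⟨_, ⟨k, by simpa using hk⟩, (eq_isoVert this).symm⟩
    exfalso
    push Not at h0 hl
    have : Nonempty (Fin d) := ⟨⟨0, by omega⟩⟩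
    obtain ⟨k, hk⟩ := Finite.exists_min fun i => min (-x i) (x i + ℓ)
    set ε := min (-x k) (x k + ℓ) with hε
    have hpos : 0 < ε := by
      apply lt_min
      · have := lt_of_le_of_ne (hxP.1 k).2 (h0 k)
        linarith
      · have := lt_of_le_of_ne (hxP.1 k).1 (hl k).symm
        linarith
    have hP : ∀ t, |t| ≤ ε → (fun i => x i + t) ∈ isocantedPolytope d ℓ a := by
      intro t ht
      have ht := abs_le.1 ht
      refine ⟨fun i => ?_, fun i j hij => by linarith [hxP.2 i j hij]⟩
      have h1 := le_min_iff.1 (hk i)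
      constructor <;> linarith
    have := hx.2 (hP ε (abs_of_pos hpos).le) (hP (-ε) (by rw [abs_neg, abs_of_pos hpos]))
      ⟨1/2, 1/2, by norm_num, by norm_num, by norm_num, by
        ext j; simp only [Pi.add_apply, Pi.smul_apply, smul_eq_mul]; ring⟩
    have := congrFun this k
    linarith
  · rintro (⟨S, ⟨k, hk⟩, rfl⟩ | ⟨S, ⟨k, hk⟩, rfl⟩)
    · refine ⟨⟨fun i => ?_, fun i j _ => ?_⟩, ?_⟩
      · simp only [isoVert]; split_ifs <;> constructor <;> linarith
      · simp only [isoVert]; split_ifs <;> linarith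
      · rintro y hy z hz ⟨s, t, hs, ht, hst, h⟩
        have h' : ∀ i, s * y i + t * z i = if i ∈ S then 0 else a - ℓ := fun i => congrFun h i
        have key : ∀ i ∈ S, y i = 0 ∧ z i = 0 := fun i hi =>
          seg_eq_high hs ht hst (by simpa [hi] using h' i) (hy.1 i).2 (hz.1 i).2
        obtain ⟨ky, kz⟩ := key k hk
        ext i
        by_cases hi : i ∈ S
        · simp [isoVert, hi, key i hi]
        · have hne : k ≠ i := fun e => hi (e ▸ hk)
          simp only [isoVert, hi, if_false]
          have h1 := hy.2 k i hne
          have h2 := hz.2 k i hne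
          exact (seg_eq_low hs ht hst (by simpa [hi] using h' i) (by linarith) (by linarith)).1
    · refine ⟨⟨fun i => ?_, fun i j _ => ?_⟩, ?_⟩
      · simp only [isoVert]; split_ifs <;> constructor <;> linarith
      · simp only [isoVert]; split_ifs <;> linarith
      · rintro y hy z hz ⟨s, t, hs, ht, hst, h⟩
        have h' : ∀ i, s * y i + t * z i = if i ∈ S then -ℓ else -a := fun i => congrFun h i
        have key : ∀ i ∈ S, y i = -ℓ ∧ z i = -ℓ := fun i hi =>
          seg_eq_low hs ht hst (by simpa [hi] using h' i) (hy.1 i).1 (hz.1 i).1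
        obtain ⟨ky, kz⟩ := key k hk
        ext i
        by_cases hi : i ∈ S
        · simp [isoVert, hi, key i hi]
        · have hne : i ≠ k := fun e => hi (e ▸ hk)
          simp only [isoVert, hi, if_false]
          have h1 := hy.2 i k hne
          have h2 := hz.2 i k hne
          exact (seg_eq_high hs ht hst (by simpa [hi] using h' i) (by linarith) (by linarith)).1

theorem card_extremePoints_isocanted (d : ℕ) (hd : 2 ≤ d) (ℓ a : ℝ)
    (ha : 0 < a) (haℓ : a < ℓ) :
    (Set.extremePoints ℝ (isocantedPolytope d ℓ a)).Finite ∧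
      (Set.extremePoints ℝ (isocantedPolytope d ℓ a)).ncard = 2 ^ (d + 1) - 2 := by
  rw [extremePoints_iso d hd ℓ a ha haℓ]
  refine ⟨(Set.toFinite _).union (Set.toFinite _), ?_⟩
  have hcard : ({S : Finset (Fin d) | S.Nonempty}).ncard = 2 ^ d - 1 := by
    have : {S : Finset (Fin d) | S.Nonempty} =
        ((Finset.univ.erase ∅ : Finset (Finset (Fin d))) : Set (Finset (Fin d))) := by
      ext S; simp [Finset.nonempty_iff_ne_empty]
    rw [this, Set.ncard_coe_finset, Finset.card_erase_of_mem (Finset.mem_univ _)]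
    simp
  rw [Set.ncard_union_eq _ (Set.toFinite _) (Set.toFinite _),
    Set.ncard_image_of_injective _ (isoVert_injective d (by linarith)),
    Set.ncard_image_of_injective _ (isoVert_injective d (by linarith)), hcard, pow_succ]
  · omega
  · rw [Set.disjoint_left]
    rintro _ ⟨S, ⟨k, hk⟩, rfl⟩ ⟨T, -, h⟩
    have := congrFun h k
    simp only [isoVert, hk, if_true] at this
    split_ifs at this <;> linarith
end

section
/- Let d ≥ 2 be an integer and let ℓ, a be real numbers with 0 < a < ℓ. The isocanted alcoved polytope P(d,ℓ,a) is a zonotope: it equals the Minkowski sum of the box [−ℓ, −a]^d and the segment {t·(1,1,…,1) : t ∈ [0,a]}; that is, x ∈ P(d,ℓ,a) if and only if there exist b ∈ ℝ^d with −ℓ ≤ b i ≤ −a for all i and t ∈ [0,a] such that x = b + t·(1,…,1). -/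
theorem isocanted_is_zonotope (d : ℕ) (hd : 2 ≤ d) (ℓ a : ℝ)
    (ha : 0 < a) (haℓ : a < ℓ) (x : Fin d → ℝ) :
    x ∈ isocantedPolytope d ℓ a ↔
      ∃ (b : Fin d → ℝ) (t : ℝ), (∀ i, -ℓ ≤ b i ∧ b i ≤ -a) ∧
        0 ≤ t ∧ t ≤ a ∧ x = fun i => b i + t := by
  constructor
  · rintro ⟨h1, h2⟩
    haveI : Nonempty (Fin d) := ⟨⟨0, by omega⟩⟩
    obtain ⟨m, hm⟩ := Finite.exists_max x
    refine ⟨fun i => x i - max 0 (x m + a), max 0 (x m + a), ?_, le_max_left _ _, ?_, ?_⟩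
    · intro i
      have hle : max 0 (x m + a) ≤ x i + ℓ := by
        apply max_le
        · linarith [(h1 i).1]
        · by_cases hmi : m = i
          · subst hmi; linarith
          · linarith [h2 m i hmi]
      have hge : x m + a ≤ max 0 (x m + a) := le_max_right _ _
      constructor
      · show -ℓ ≤ x i - max 0 (x m + a)
        linarith
      · show x i - max 0 (x m + a) ≤ -a
        linarith [hm i]
    · exact max_le ha.le (by linarith [(h1 m).2])
    · funext i
      simp
  · rintro ⟨b, t, hb, ht0, hta, rfl⟩
    refine ⟨fun i => ⟨?_, ?_⟩, fun i j _ => ?_⟩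
    · show -ℓ ≤ b i + t
      linarith [(hb i).1]
    · show b i + t ≤ 0
      linarith [(hb i).2]
    · show b i + t - (b j + t) ≤ ℓ - a
      linarith [(hb i).2, (hb j).1]
end

section
/- For every integer d ≥ 2, the finite sequence I(d,0), I(d,1), …, I(d,d−1) is log-concave: for all k with 0 ≤ k and k+2 ≤ d−1 one has I(d,k+1)^2 ≥ I(d,k)·I(d,k+2). -/
/-- `I d j = (2^(d+1-j) - 2) * C(d+1, j)`, the number of `j`-dimensional faces of an
isocanted alcoved `d`-polytope. -/
def I (d j : ℕ) : ℕ := (2 ^ (d + 1 - j) - 2) * Nat.choose (d + 1) j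

theorem choose_lc_aux (n k m : ℕ) (h : n = k + 2 + m) :
    n.choose k * n.choose (k + 2) ≤ n.choose (k + 1) ^ 2 := by
  have h1 := Nat.choose_succ_right_eq n k
  have h2 := Nat.choose_succ_right_eq n (k + 1)
  rw [show n - k = m + 2 by omega] at h1
  rw [show n - (k + 1) = m + 1 by omega, show k + 1 + 1 = k + 2 by omega] at h2
  generalize n.choose k = a at *
  generalize n.choose (k + 1) = b at *
  generalize n.choose (k + 2) = c at *
  have hpos : 0 < (m + 2) * (k + 2) := by positivity
  refine Nat.le_of_mul_le_mul_right ?_ hpos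
  calc a * c * ((m + 2) * (k + 2)) = (a * (m + 2)) * (c * (k + 2)) := by ring
    _ = b ^ 2 * ((m + 1) * (k + 1)) := by rw [← h1, h2]; ring
    _ ≤ b ^ 2 * ((m + 2) * (k + 2)) := by gcongr <;> omega

theorem I_log_concave (d : ℕ) (hd : 2 ≤ d) :
    ∀ k, k + 2 ≤ d - 1 → I d k * I d (k + 2) ≤ I d (k + 1) ^ 2 := by
  intro k hk
  obtain ⟨m, hm⟩ : ∃ m, d + 1 = k + 2 + (m + 1) := ⟨d - k - 2, by omega⟩
  have hc := choose_lc_aux (d + 1) k (m + 1) hm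
  unfold I
  rw [show d + 1 - k = m + 1 + 2 by omega, show d + 1 - (k + 2) = m + 1 by omega,
    show d + 1 - (k + 1) = m + 1 + 1 by omega]
  obtain ⟨y, hy⟩ : ∃ y, 2 ^ (m + 1) = y + 2 :=
    ⟨2 ^ (m + 1) - 2, by have := Nat.one_le_two_pow (n := m); rw [pow_succ]; omega⟩
  rw [pow_add _ (m + 1) 2, pow_succ _ (m + 1), hy,
    show (y + 2) * 2 ^ 2 - 2 = 4 * y + 6 by omega, show y + 2 - 2 = y by omega,
    show (y + 2) * 2 - 2 = 2 * y + 2 by omega]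
  have hp : (4 * y + 6) * y ≤ (2 * y + 2) ^ 2 := by nlinarith
  calc _ = ((4 * y + 6) * y) * ((d + 1).choose k * (d + 1).choose (k + 2)) := by ring
    _ ≤ (2 * y + 2) ^ 2 * (d + 1).choose (k + 1) ^ 2 := Nat.mul_le_mul hp hc
    _ = _ := by ring
end

section
/- (Bárány's conjecture for isocanted alcoved polytopes.) For every integer d ≥ 2 and every k with 0 ≤ k ≤ d−1, one has I(d,k) ≥ min{I(d,0), I(d,d−1)}; moreover this minimum equals I(d,d−1) = (d+1)·d, so I(d,k) ≥ (d+1)·d for all such k. -/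
lemma base_aux (p : ℕ) : (p + 2) * (p + 1) ≤ 2 ^ (p + 2) - 2 := by
  have h : (p + 2) * (p + 1) + 2 ≤ 2 ^ (p + 2) := by
    induction p with
    | zero => norm_num
    | succ p ih =>
      rw [show p + 1 + 2 = (p + 2) + 1 from rfl, pow_succ]
      nlinarith [Nat.zero_le (p * p)]
  omega

lemma main_aux (p k : ℕ) :
    (p + k + 2) * (p + k + 1) ≤ (2 ^ (p + 2) - 2) * Nat.choose (p + k + 2) k := by
  induction k with
  | zero => simpa using base_aux p
  | succ k ih =>
    have h := Nat.add_one_mul_choose_eq (p + k + 2) k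
    generalize 2 ^ (p + 2) - 2 = a at *
    rw [show p + (k + 1) + 2 = p + k + 2 + 1 by ring]
    generalize Nat.choose (p + k + 2) k = c at *
    generalize Nat.choose (p + k + 2 + 1) (k + 1) = e at *
    refine Nat.le_of_mul_le_mul_right (c := k + 1) ?_ (Nat.succ_pos k)
    calc (p + k + 2 + 1) * (p + (k + 1) + 1) * (k + 1)
        ≤ (p + k + 2 + 1) * (p + (k + 1) + 1) * (p + k + 1) :=
          Nat.mul_le_mul_left _ (by omega)
      _ = (p + k + 2 + 1) * ((p + k + 2) * (p + k + 1)) := by ring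
      _ ≤ (p + k + 2 + 1) * (a * c) := Nat.mul_le_mul_left _ ih
      _ = a * ((p + k + 2 + 1) * c) := by ring
      _ = a * e * (k + 1) := by rw [h]; ring

theorem barany_for_isocanted (d : ℕ) (hd : 2 ≤ d) :
    (∀ k, k ≤ d - 1 → min (I d 0) (I d (d - 1)) ≤ I d k) ∧
    min (I d 0) (I d (d - 1)) = I d (d - 1) ∧
    I d (d - 1) = (d + 1) * d ∧
    (∀ k, k ≤ d - 1 → (d + 1) * d ≤ I d k) := by
  have h1 : ∀ k, k ≤ d - 1 → (d + 1) * d ≤ I d k := by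
    intro k hk
    obtain ⟨p, rfl⟩ : ∃ p, d = p + k + 1 := ⟨d - 1 - k, by omega⟩
    have := main_aux p k
    unfold I
    rwa [show p + k + 1 + 1 - k = p + 2 by omega]
  have h2 : I d (d - 1) = (d + 1) * d := by
    obtain ⟨e, rfl⟩ : ∃ e, d = e + 1 := ⟨d - 1, by omega⟩
    unfold I
    rw [show e + 1 + 1 - (e + 1 - 1) = 2 by omega, show e + 1 - 1 = e by omega]
    have h3 : Nat.choose (e + 1 + 1) e = Nat.choose (e + 2) 2 :=
      Nat.choose_symm_of_eq_add (by omega)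
    have h4 := Nat.add_one_mul_choose_eq (e + 1) 1
    rw [Nat.choose_one_right] at h4
    rw [h3]
    norm_num at h4 ⊢
    linarith
  refine ⟨fun k hk => ?_, ?_, h2, h1⟩
  · exact (min_le_right _ _).trans (h2 ▸ h1 k hk)
  · exact min_eq_right (h2 ▸ h1 0 (Nat.zero_le _))
end

section
/- For every integer d ≥ 2, the total number of nonempty faces (including the polytope itself) of an isocanted alcoved d-polytope satisfies ∑_{k=0}^{d−1} I(d,k) + 1 = 3^(d+1) − 2^(d+2) + 2; equivalently, ∑_{k=0}^{d−1} (2^(d+1−k) − 2)·C(d+1,k) + 1 + 2^(d+2) = 3^(d+1) + 2. -/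
theorem total_face_count (d : ℕ) (hd : 2 ≤ d) :
    (∑ k ∈ Finset.range d, I d k) + 1 + 2 ^ (d + 2) = 3 ^ (d + 1) + 2 := by
  have h3 := add_pow (1 : ℕ) 2 (d + 1)
  have h2 := Nat.sum_range_choose (d + 1)
  rw [Finset.sum_range_succ, Finset.sum_range_succ] at h3 h2
  have hS : (∑ k ∈ Finset.range d, I d k) + 2 * ∑ k ∈ Finset.range d, (d + 1).choose k
      = ∑ k ∈ Finset.range d, 1 ^ k * 2 ^ (d + 1 - k) * (d + 1).choose k := by
    rw [Finset.mul_sum, ← Finset.sum_add_distrib]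
    refine Finset.sum_congr rfl fun k hk => ?_
    have hk' := Finset.mem_range.mp hk
    have hp : 2 ≤ 2 ^ (d + 1 - k) := by
      calc 2 = 2 ^ 1 := by norm_num
        _ ≤ 2 ^ (d + 1 - k) := Nat.pow_le_pow_right (by norm_num) (by omega)
    rw [I, ← add_mul, Nat.sub_add_cancel hp, one_pow, one_mul]
  have e : d + 1 - d = 1 := by omega
  have hc : (d + 1).choose d = d + 1 := Nat.choose_succ_self_right d
  simp only [e, hc, Nat.choose_self, Nat.sub_self, one_pow, pow_zero, pow_one, one_mul,
    Nat.cast_id] at h3 h2 hS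
  have h12 : (1 + 2 : ℕ) = 3 := rfl
  rw [h12] at h3
  have hp2 : 2 ^ (d + 2) = 2 * 2 ^ (d + 1) := by ring
  omega
end
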